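/- Let A be a nonempty finite set, let (O, F) be a measurable space, let R : O → [0,1] be measurable, and let s > 0. Let M and M̄ both assign to each a ∈ A a probability measure on O. Set λ_a = E_{o∼M̄(a)}[R(o)²] for each a ∈ A and C = Σ_{a∈A} λ_a, and assume C ≤ s. Define q : A → ℝ by q(a) = (1/|A|)·(1 − C/(2s)) + λ_a/(2s). Then q is a probability distribution on A, and, writing f_M(a) = E_{o∼M(a)}[R(o)], f_M̄(a) = E_{o∼M̄(a)}[R(o)] and D = Σ_{a'∈A} q(a')·H²(M(a'), M̄(a')), for every a ∈ A: |f_M(a) − f_M̄(a)| ≤ 4·√(2·s·D) + 8·|A|·D. -/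

import Mathlib

open MeasureTheory

/-- Squared Hellinger distance `H²(P,Q) = ½ ∫ (√(dP/dμ) − √(dQ/dμ))² dμ`,
computed with the dominating measure `μ = P + Q`. -/
noncomputable def sqHellinger {Z : Type*} [MeasurableSpace Z] (P Q : Measure Z) : ℝ :=
  (1 / 2) * ∫ z, (Real.sqrt ((P.rnDeriv (P + Q) z).toReal)
      - Real.sqrt ((Q.rnDeriv (P + Q) z).toReal)) ^ 2 ∂(P + Q)

/-- Cauchy–Schwarz for square-integrable real functions, in squared form. -/
lemma sq_integral_mul_le {Z : Type*} [MeasurableSpace Z] {μ : Measure Z} {f g : Z → ℝ}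
    (hf : MemLp f 2 μ) (hg : MemLp g 2 μ) :
    (∫ z, f z * g z ∂μ) ^ 2 ≤ (∫ z, f z ^ 2 ∂μ) * ∫ z, g z ^ 2 ∂μ := by
  have hfg : Integrable (fun z => f z * g z) μ := hf.integrable_mul hg
  have key : ∀ x : ℝ, 0 ≤ (∫ z, f z ^ 2 ∂μ) * (x * x) + (2 * ∫ z, f z * g z ∂μ) * x
      + ∫ z, g z ^ 2 ∂μ := by
    intro x
    have h0 : 0 ≤ ∫ z, (x * f z + g z) ^ 2 ∂μ := integral_nonneg fun z => sq_nonneg _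
    have h1 : ∫ z, (x * f z + g z) ^ 2 ∂μ
        = ∫ z, (x * x * f z ^ 2 + 2 * x * (f z * g z) + g z ^ 2) ∂μ := by
      congr 1
      ext z
      ring
    have hf' : Integrable (fun z => x * x * f z ^ 2) μ := hf.integrable_sq.const_mul _
    have hfg' : Integrable (fun z => 2 * x * (f z * g z)) μ := hfg.const_mul _
    have hadd : Integrable (fun z => x * x * f z ^ 2 + 2 * x * (f z * g z)) μ := hf'.add hfg'
    rw [h1, integral_add hadd hg.integrable_sq, integral_add hf' hfg', integral_const_mul,
      integral_const_mul] at h0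
    linarith
  have h := discrim_le_zero key
  rw [discrim] at h
  linarith

lemma sqHellinger_nonneg {Z : Type*} [MeasurableSpace Z] (P Q : Measure Z) :
    0 ≤ sqHellinger P Q :=
  mul_nonneg (by norm_num) (integral_nonneg fun _ => sq_nonneg _)

/-- Localized change of measure: the difference of the means of a `[0,1]`-valued function is
controlled by the Hellinger distance and the second moment under one of the two measures. -/
lemma abs_integral_sub_integral_le_sqHellinger {Z : Type*} [MeasurableSpace Z] (P Q : Measure Z)
    [IsFiniteMeasure P] [IsFiniteMeasure Q] {R : Z → ℝ} (hR : Measurable R)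
    (hR01 : ∀ z, R z ∈ Set.Icc (0 : ℝ) 1) :
    |(∫ z, R z ∂P) - ∫ z, R z ∂Q|
      ≤ 2 * √(2 * ((∫ z, R z ^ 2 ∂Q) * sqHellinger P Q)) + 2 * sqHellinger P Q := by
  set μ := P + Q with hμ
  have hP : P ≪ μ := Measure.AbsolutelyContinuous.rfl.add_right Q
  have hQ : Q ≪ μ := by
    rw [hμ, add_comm]
    exact Measure.AbsolutelyContinuous.rfl.add_right P
  set u : Z → ℝ := fun z => √((P.rnDeriv μ z).toReal) with hu
  set v : Z → ℝ := fun z => √((Q.rnDeriv μ z).toReal) with hv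
  have hu2 : ∀ z, (P.rnDeriv μ z).toReal = u z ^ 2 := fun z =>
    (Real.sq_sqrt ENNReal.toReal_nonneg).symm
  have hv2 : ∀ z, (Q.rnDeriv μ z).toReal = v z ^ 2 := fun z =>
    (Real.sq_sqrt ENNReal.toReal_nonneg).symm
  have hum : Measurable u := (Measure.measurable_rnDeriv P μ).ennreal_toReal.sqrt
  have hvm : Measurable v := (Measure.measurable_rnDeriv Q μ).ennreal_toReal.sqrt
  have huL : MemLp u 2 μ := (memLp_two_iff_integrable_sq hum.aestronglyMeasurable).2 <| by
    simpa only [hu2] using Measure.integrable_toReal_rnDeriv (μ := P) (ν := μ)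
  have hvL : MemLp v 2 μ := (memLp_two_iff_integrable_sq hvm.aestronglyMeasurable).2 <| by
    simpa only [hv2] using Measure.integrable_toReal_rnDeriv (μ := Q) (ν := μ)
  have hmul : ∀ {w : Z → ℝ}, Measurable w → MemLp w 2 μ → MemLp (fun z => R z * w z) 2 μ := by
    intro w hwm hw
    refine hw.of_le (hR.mul hwm).aestronglyMeasurable (.of_forall fun z => ?_)
    rw [norm_mul, Real.norm_of_nonneg (hR01 z).1]
    exact mul_le_of_le_one_left (norm_nonneg _) (hR01 z).2
  have hdL : MemLp (fun z => u z - v z) 2 μ := huL.sub hvL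
  have hdm : Measurable (fun z => u z - v z) := hum.sub hvm
  have hH : ∫ z, (u z - v z) ^ 2 ∂μ = 2 * sqHellinger P Q := by
    simp only [sqHellinger, hu, hv, hμ]
    ring
  have hIP : ∫ z, R z ∂P = ∫ z, R z * u z * u z ∂μ := by
    rw [← integral_rnDeriv_smul hP]
    congr 1
    ext z
    rw [smul_eq_mul, hu2]
    ring
  have hIQ : ∫ z, R z ∂Q = ∫ z, R z * v z * v z ∂μ := by
    rw [← integral_rnDeriv_smul hQ]
    congr 1
    ext z
    rw [smul_eq_mul, hv2]
    ring
  have hIQ2 : ∫ z, R z ^ 2 ∂Q = ∫ z, (R z * v z) ^ 2 ∂μ := by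
    rw [← integral_rnDeriv_smul hQ]
    congr 1
    ext z
    rw [smul_eq_mul, hv2]
    ring
  have hcross : Integrable (fun z => R z * v z * (u z - v z)) μ :=
    (hmul hvm hvL).integrable_mul hdL
  have hquad : Integrable (fun z => R z * (u z - v z) * (u z - v z)) μ :=
    (hmul hdm hdL).integrable_mul hdL
  have hsplit : (∫ z, R z ∂P) - ∫ z, R z ∂Q
      = 2 * (∫ z, R z * v z * (u z - v z) ∂μ) + ∫ z, R z * (u z - v z) * (u z - v z) ∂μ := by
    have hRu : Integrable (fun z => R z * u z * u z) μ := (hmul hum huL).integrable_mul huL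
    have hRv : Integrable (fun z => R z * v z * v z) μ := (hmul hvm hvL).integrable_mul hvL
    rw [hIP, hIQ, ← integral_sub hRu hRv, ← integral_const_mul,
      ← integral_add (hcross.const_mul 2) hquad]
    congr 1
    ext z
    ring
  have hcs := sq_integral_mul_le (hmul hvm hvL) hdL
  rw [← hIQ2, hH] at hcs
  have hcs_abs : |∫ z, R z * v z * (u z - v z) ∂μ|
      ≤ √(2 * ((∫ z, R z ^ 2 ∂Q) * sqHellinger P Q)) :=
    Real.abs_le_sqrt (hcs.trans_eq (by ring))
  have hq0 : 0 ≤ ∫ z, R z * (u z - v z) * (u z - v z) ∂μ := integral_nonneg fun z => by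
    rw [mul_assoc]
    exact mul_nonneg (hR01 z).1 (mul_self_nonneg _)
  have hq1 : ∫ z, R z * (u z - v z) * (u z - v z) ∂μ ≤ 2 * sqHellinger P Q := by
    rw [← hH]
    refine integral_mono hquad hdL.integrable_sq fun z => ?_
    simp only [mul_assoc, ← sq]
    exact mul_le_of_le_one_left (sq_nonneg _) (hR01 z).2
  rw [hsplit]
  rw [abs_le] at hcs_abs ⊢
  constructor <;> linarith [hcs_abs.1, hcs_abs.2]

/-- Key step in the sparse DEC bound: with `λ_a = E_{o∼M̄(a)}[R(o)²]`,
`C = ∑_a λ_a ≤ s` and the exploration distribution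
`q(a) = (1/|A|)(1 − C/(2s)) + λ_a/(2s)`, the distribution `q` is a probability
distribution and, with `D = ∑_{a'} q(a') H²(M(a'), M̄(a'))`, every action `a` satisfies
`|f_M(a) − f_M̄(a)| ≤ 4√(2sD) + 8|A|D`. -/
theorem sparse_exploration_distribution_bound {A : Type*} [Fintype A] [Nonempty A]
    {O : Type*} [MeasurableSpace O]
    (R : O → ℝ) (hR : Measurable R) (hR01 : ∀ o, R o ∈ Set.Icc (0 : ℝ) 1)
    (s : ℝ) (hs : 0 < s)
    (M Mbar : A → Measure O)
    (hM : ∀ a, IsProbabilityMeasure (M a)) (hMbar : ∀ a, IsProbabilityMeasure (Mbar a))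
    (lam : A → ℝ) (hlam : ∀ a, lam a = ∫ o, (R o) ^ 2 ∂(Mbar a))
    (C : ℝ) (hC : C = ∑ a, lam a) (hCs : C ≤ s)
    (q : A → ℝ)
    (hq : ∀ a, q a = (1 / (Fintype.card A : ℝ)) * (1 - C / (2 * s)) + lam a / (2 * s))
    (D : ℝ) (hD : D = ∑ a', q a' * sqHellinger (M a') (Mbar a')) :
    ((∀ a, 0 ≤ q a) ∧ ∑ a, q a = 1) ∧
      ∀ a, |(∫ o, R o ∂(M a)) - ∫ o, R o ∂(Mbar a)|
        ≤ 4 * Real.sqrt (2 * s * D) + 8 * (Fintype.card A : ℝ) * D := by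
  have hN : (0 : ℝ) < Fintype.card A := by exact_mod_cast Fintype.card_pos
  have hlam0 : ∀ a, 0 ≤ lam a := fun a => by
    rw [hlam]
    exact integral_nonneg fun _ => sq_nonneg _
  have hhalf : C / (2 * s) ≤ 1 / 2 := by
    rw [div_le_div_iff₀ (by positivity) (by norm_num)]
    linarith
  have hunif : ∀ a, 1 / (2 * (Fintype.card A : ℝ)) ≤ q a := fun a => by
    have h1 : 1 / (Fintype.card A : ℝ) * (1 / 2)
        ≤ 1 / (Fintype.card A : ℝ) * (1 - C / (2 * s)) :=
      mul_le_mul_of_nonneg_left (by linarith) (by positivity)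
    have h2 : 0 ≤ lam a / (2 * s) := div_nonneg (hlam0 a) (by positivity)
    have h3 : 1 / (2 * (Fintype.card A : ℝ)) = 1 / (Fintype.card A : ℝ) * (1 / 2) := by
      field_simp
    rw [hq]
    linarith
  have hlamq : ∀ a, lam a / (2 * s) ≤ q a := fun a => by
    have h1 : 0 ≤ 1 / (Fintype.card A : ℝ) * (1 - C / (2 * s)) :=
      mul_nonneg (by positivity) (by linarith)
    rw [hq]
    linarith
  have hq0 : ∀ a, 0 ≤ q a := fun a => le_trans (by positivity) (hunif a)
  refine ⟨⟨hq0, ?_⟩, fun a => ?_⟩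
  · simp only [hq]
    rw [Finset.sum_add_distrib, ← Finset.sum_div, ← hC, Finset.sum_const, Finset.card_univ,
      nsmul_eq_mul]
    field_simp
    ring
  · have hh := sqHellinger_nonneg (M a) (Mbar a)
    have hbound := abs_integral_sub_integral_le_sqHellinger (M a) (Mbar a) hR hR01
    rw [← hlam] at hbound
    set h := sqHellinger (M a) (Mbar a)
    have hqD : q a * h ≤ D := by
      rw [hD]
      exact Finset.single_le_sum
        (f := fun a' => q a' * sqHellinger (M a') (Mbar a'))
        (fun a' _ => mul_nonneg (hq0 a') (sqHellinger_nonneg _ _)) (Finset.mem_univ a)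
    have hD0 : 0 ≤ D := (mul_nonneg (hq0 a) hh).trans hqD
    have hND : h ≤ 2 * Fintype.card A * D := by
      have := (mul_le_mul_of_nonneg_right (hunif a) hh).trans hqD
      rw [div_mul_eq_mul_div, one_mul, div_le_iff₀ (by positivity)] at this
      linarith
    have hsD : lam a * h ≤ 2 * s * D := by
      have := (mul_le_mul_of_nonneg_right (hlamq a) hh).trans hqD
      rw [div_mul_eq_mul_div, div_le_iff₀ (by positivity)] at this
      linarith
    have hsD0 : 0 ≤ 2 * s * D := by positivity
    have hsqrt : √(2 * (lam a * h)) ≤ 2 * √(2 * s * D) := by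
      refine Real.sqrt_le_iff.2 ⟨by positivity, ?_⟩
      rw [mul_pow, Real.sq_sqrt hsD0]
      linarith
    have hND0 : 0 ≤ (Fintype.card A : ℝ) * D := by positivity
    linarith
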